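/- Let ℱ be a collection of r-graphs, let 0 < p < 1, let ε > 0, and let c = c(p,ℱ). Then there exist η, γ, λ > 0 and an integer m (depending only on ℱ, p, ε) such that, for all sufficiently large n, the following holds. Let 𝒜 be any collection of r-graphs on a vertex set V of size n with μ_n(𝒜) > 2^{(-c+ε)·C(n,r)}, and let 𝒟 = {D₁,…,D_d} be any partial Steiner system with parameters (r,m,n) on V with d ≥ (1-λ)·C(n,r)·C(m,r)^{-1}. Let I = {i ∈ [d] : μ_n({G ∈ 𝒜 : ℱ < G[D_i]}) ≥ γ·μ_n(𝒜)}. Then |I| ≥ η·d. -/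

import Mathlib

open Finset

/-- The set of all potential edges of an `r`-uniform hypergraph on vertex set `Fin n`:
the `r`-element subsets of the vertex set. -/
def edgeUniv (r n : ℕ) : Finset (Finset (Fin n)) := Finset.powersetCard r Finset.univ

/-- `G` is an `r`-uniform hypergraph on `Fin n`: a set of `r`-element subsets of the vertices. -/
def IsRGraph (r n : ℕ) (G : Finset (Finset (Fin n))) : Prop := G ⊆ edgeUniv r n

/-- The probability that the random `r`-graph `G(n,p)` (each `r`-set being an edge
independently with probability `p`) belongs to the collection `A`. -/
noncomputable def prG (r n : ℕ) (p : ℝ) (A : Set (Finset (Finset (Fin n)))) : ℝ :=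
  ∑ E ∈ (edgeUniv r n).powerset,
    Set.indicator A (fun E => p ^ E.card * (1 - p) ^ ((edgeUniv r n).card - E.card)) E

/-- The `r`-graph `F` on `Fin k` appears as an induced subgraph of `G` (an `r`-graph on
`Fin n`) on the vertex subset `U`. -/
def IsInducedCopyAt (r k n : ℕ) (F : Finset (Finset (Fin k)))
    (G : Finset (Finset (Fin n))) (U : Finset (Fin n)) : Prop :=
  ∃ f : Fin k ↪ Fin n, Finset.univ.map f = U ∧
    ∀ e : Finset (Fin k), e.card = r → (e ∈ F ↔ e.map f ∈ G)

/-- `G` has an induced subgraph on the vertex subset `U` isomorphic to a member of the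
family `Fam` (where `Fam k` is the set of members of the family on `k` vertices). -/
def HasCopyAt (r n : ℕ) (Fam : ∀ k, Set (Finset (Finset (Fin k))))
    (G : Finset (Finset (Fin n))) (U : Finset (Fin n)) : Prop :=
  ∃ k, ∃ H ∈ Fam k, IsInducedCopyAt r k n H G U

/-- `Forb(Fam)ⁿ` : the `r`-graphs on `n` vertices with no induced subgraph isomorphic to a
member of `Fam`. -/
def ForbN (r : ℕ) (Fam : ∀ k, Set (Finset (Finset (Fin k)))) (n : ℕ) :
    Set (Finset (Finset (Fin n))) :=
  {G | IsRGraph r n G ∧ ∀ U, ¬ HasCopyAt r n Fam G U}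

/-- A partial Steiner system with parameters `(r,m,n)`: a collection of `m`-element
subsets of `Fin n` such that every `r`-element subset is contained in at most one member. -/
def IsSteiner (r m n : ℕ) (D : Finset (Finset (Fin n))) : Prop :=
  (∀ B ∈ D, B.card = m) ∧
  ∀ e : Finset (Fin n), e.card = r →
    ∀ B₁ ∈ D, ∀ B₂ ∈ D, e ⊆ B₁ → e ⊆ B₂ → B₁ = B₂

/-- Expectation of `f` over the random subset of `S` with density `p`. -/
noncomputable def exS {α : Type*} (p : ℝ) (S : Finset α) (f : Finset α → ℝ) : ℝ :=
  ∑ E ∈ S.powerset, p ^ E.card * (1 - p) ^ (S.card - E.card) * f E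

lemma exS_one {α : Type*} (p : ℝ) (S : Finset α) : exS p S (fun _ => 1) = 1 := by
  have := Finset.sum_pow_mul_eq_add_pow p (1 - p) S
  simp only [exS, mul_one]
  rw [this]; simp

lemma exS_congr {α : Type*} (p : ℝ) (S : Finset α) (f g : Finset α → ℝ)
    (h : ∀ E ⊆ S, f E = g E) : exS p S f = exS p S g := by
  unfold exS
  refine Finset.sum_congr rfl fun E hE => ?_
  rw [h E (Finset.mem_powerset.1 hE)]

lemma exS_mono {α : Type*} (p : ℝ) (hp0 : 0 < p) (hp1 : p < 1) (S : Finset α)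
    (f g : Finset α → ℝ)
    (h : ∀ E ⊆ S, f E ≤ g E) : exS p S f ≤ exS p S g := by
  unfold exS
  refine Finset.sum_le_sum fun E hE => ?_
  have h1 : 0 < 1 - p := by linarith
  exact mul_le_mul_of_nonneg_left (h E (Finset.mem_powerset.1 hE)) (by positivity)

lemma exS_union {α : Type*} [DecidableEq α] (p : ℝ) (S T : Finset α) (hST : Disjoint S T)
    (f g : Finset α → ℝ) :
    exS p (S ∪ T) (fun E => f (E ∩ S) * g (E ∩ T)) = exS p S f * exS p T g := by
  unfold exS
  rw [Finset.sum_mul_sum, ← Finset.sum_product']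
  symm
  refine Finset.sum_nbij' (fun x => x.1 ∪ x.2) (fun E => (E ∩ S, E ∩ T)) ?_ ?_ ?_ ?_ ?_
  · rintro ⟨a, b⟩ h
    simp only [Finset.mem_product, Finset.mem_powerset] at h ⊢
    exact Finset.union_subset_union h.1 h.2
  · intro E _
    simp only [Finset.mem_product, Finset.mem_powerset]
    exact ⟨Finset.inter_subset_right, Finset.inter_subset_right⟩
  · rintro ⟨a, b⟩ h
    simp only [Finset.mem_product, Finset.mem_powerset] at h
    rw [Finset.disjoint_left] at hST
    ext x
    · simp only [Finset.mem_inter, Finset.mem_union]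
      have h1 := @h.1 x
      have h2 := @h.2 x
      have h3 := @hST x
      tauto
    · simp only [Finset.mem_inter, Finset.mem_union]
      have h1 := @h.1 x
      have h2 := @h.2 x
      have h3 := @hST x
      tauto
  · intro E hE
    simp only [Finset.mem_powerset] at hE
    rw [← Finset.inter_union_distrib_left]
    exact Finset.inter_eq_left.2 hE
  · rintro ⟨a, b⟩ h
    simp only [Finset.mem_product, Finset.mem_powerset] at h
    have hab : Disjoint a b := Finset.disjoint_of_subset_left h.1
      (Finset.disjoint_of_subset_right h.2 hST)
    have e1 : (a ∪ b) ∩ S = a := by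
      rw [Finset.disjoint_left] at hST
      ext x
      simp only [Finset.mem_inter, Finset.mem_union]
      have h1 := @h.1 x
      have h2 := @h.2 x
      have h3 := @hST x
      tauto
    have e2 : (a ∪ b) ∩ T = b := by
      rw [Finset.disjoint_left] at hST
      ext x
      simp only [Finset.mem_inter, Finset.mem_union]
      have h1 := @h.1 x
      have h2 := @h.2 x
      have h3 := @hST x
      tauto
    simp only [e1, e2]
    rw [Finset.card_union_of_disjoint hST, Finset.card_union_of_disjoint hab]
    have c1 := Finset.card_le_card h.1
    have c2 := Finset.card_le_card h.2
    have : S.card + T.card - (a.card + b.card) = (S.card - a.card) + (T.card - b.card) := by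
      omega
    rw [this, pow_add, pow_add]
    ring

lemma exS_sub {α : Type*} [DecidableEq α] (p : ℝ) (S T : Finset α) (hTS : T ⊆ S)
    (f : Finset α → ℝ) : exS p S (fun E => f (E ∩ T)) = exS p T f := by
  have h := exS_union p T (S \ T) Finset.disjoint_sdiff f (fun _ => 1)
  rw [exS_one, mul_one, Finset.union_sdiff_of_subset hTS] at h
  simpa using h

lemma exS_prod {α ι : Type*} [DecidableEq α] [DecidableEq ι] (p : ℝ) (E : ι → Finset α)
    (f : ι → Finset α → ℝ) (I : Finset ι)
    (hd : ∀ i ∈ I, ∀ j ∈ I, i ≠ j → Disjoint (E i) (E j)) :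
    exS p (I.biUnion E) (fun G => ∏ i ∈ I, f i (G ∩ E i)) = ∏ i ∈ I, exS p (E i) (f i) := by
  induction I using Finset.induction_on with
  | empty => simpa using exS_one p (∅ : Finset α)
  | insert a I ha ih =>
    rw [Finset.prod_insert ha, Finset.biUnion_insert, ← ih (fun i hi j hj hij =>
      hd i (Finset.mem_insert_of_mem hi) j (Finset.mem_insert_of_mem hj) hij),
      ← exS_union]
    · refine exS_congr _ _ _ _ fun G _ => ?_
      rw [Finset.prod_insert ha]
      congr 1
      refine Finset.prod_congr rfl fun i hi => ?_
      rw [Finset.inter_assoc, Finset.inter_eq_right.2 (Finset.subset_biUnion_of_mem E hi)]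
    · rw [Finset.disjoint_biUnion_right]
      intro i hi
      refine hd a (Finset.mem_insert_self _ _) i (Finset.mem_insert_of_mem hi) ?_
      rintro rfl
      exact ha hi

lemma exS_map {α β : Type*} [DecidableEq β] (p : ℝ) (φ : α ↪ β) (S : Finset α)
    (f : Finset β → ℝ) :
    exS p (S.map φ) f = exS p S (fun E => f (E.map φ)) := by
  unfold exS
  symm
  refine Finset.sum_nbij (fun E => E.map φ) ?_ ?_ ?_ ?_
  · intro E hE
    simp only [Finset.mem_powerset] at hE ⊢
    exact Finset.map_subset_map.2 hE
  · intro a _ b _ h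
    exact Finset.map_injective φ h
  · intro E hE
    simp only [Finset.coe_powerset, Set.mem_preimage, Set.mem_powerset_iff,
      Finset.coe_subset] at hE
    obtain ⟨u, hu, rfl⟩ := Finset.subset_map_iff.1 hE
    exact ⟨u, by simpa using hu, rfl⟩
  · intro E _
    simp only [Finset.card_map]

lemma prG_eq (r n : ℕ) (p : ℝ) (A : Set (Finset (Finset (Fin n)))) :
    prG r n p A = exS p (edgeUniv r n) (Set.indicator A (fun _ => 1)) := by
  unfold prG exS
  refine Finset.sum_congr rfl fun E _ => ?_
  by_cases h : E ∈ A <;> simp [h]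

/-- Pull-back of an `r`-graph along an embedding of vertex sets. -/
def pbG (r : ℕ) {m n : ℕ} (φ : Fin m ↪ Fin n) (G : Finset (Finset (Fin n))) :
    Finset (Finset (Fin m)) :=
  (edgeUniv r m).filter (fun e => e.map φ ∈ G)

lemma pbG_copy (r : ℕ) {m n : ℕ} (Fam : ∀ k, Set (Finset (Finset (Fin k))))
    (φ : Fin m ↪ Fin n) (G : Finset (Finset (Fin n)))
    (h : pbG r φ G ∉ ForbN r Fam m) :
    ∃ U ⊆ Finset.univ.map φ, HasCopyAt r n Fam G U := by
  have h1 : IsRGraph r m (pbG r φ G) := Finset.filter_subset _ _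
  simp only [ForbN, Set.mem_ofPred_eq, not_and, not_forall, not_not] at h
  obtain ⟨U, k, H, hH, f, hf, hfe⟩ := h h1
  refine ⟨U.map φ, Finset.map_subset_map.2 (Finset.subset_univ _), k, H, hH, f.trans φ, ?_, ?_⟩
  · rw [← hf, Finset.map_map]
  · intro e he
    rw [hfe e he, pbG, Finset.mem_filter, ← Finset.map_map]
    have : e.map f ∈ edgeUniv r m := by simp [edgeUniv, he]
    simp [this]

lemma edges_map (r : ℕ) {m n : ℕ} (φ : Fin m ↪ Fin n) :
    Finset.powersetCard r (Finset.univ.map φ) =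
      (edgeUniv r m).map (Finset.mapEmbedding φ).toEmbedding := by
  rw [Finset.powersetCard_map]; rfl

lemma pbG_inter (r : ℕ) {m n : ℕ} (φ : Fin m ↪ Fin n) (G : Finset (Finset (Fin n))) :
    pbG r φ (G ∩ Finset.powersetCard r (Finset.univ.map φ)) = pbG r φ G := by
  unfold pbG
  refine Finset.filter_congr fun e he => ?_
  have he' : e.card = r := by simpa [edgeUniv] using he
  rw [Finset.mem_inter, Finset.mem_powersetCard, Finset.card_map]
  simp [he']

lemma pbG_map (r : ℕ) {m n : ℕ} (φ : Fin m ↪ Fin n) (E : Finset (Finset (Fin m)))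
    (hE : E ⊆ edgeUniv r m) :
    pbG r φ (E.map (Finset.mapEmbedding φ).toEmbedding) = E := by
  unfold pbG
  ext e
  simp only [Finset.mem_filter, Finset.mem_map]
  constructor
  · rintro ⟨_, a, ha, hae⟩
    have : a = e := Finset.map_injective φ hae
    exact this ▸ ha
  · intro h
    exact ⟨hE h, e, h, rfl⟩

lemma core (r n m d : ℕ) (Fam : ∀ k, Set (Finset (Finset (Fin k))))
    (p : ℝ) (hp0 : 0 < p) (hp1 : p < 1) (A : Set (Finset (Finset (Fin n))))
    (D : Fin d → Finset (Fin n)) (hcard : ∀ i, (D i).card = m)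
    (hdisj : ∀ i j, i ≠ j →
      Disjoint (Finset.powersetCard r (D i)) (Finset.powersetCard r (D j)))
    (s : ℝ) (hs : 0 < s) (x0 : ℝ)
    (hx : ∑ i, prG r n p {G | G ∈ A ∧ ∃ U ⊆ D i, HasCopyAt r n Fam G U} ≤ x0 * prG r n p A) :
    prG r n p A * Real.exp (-(s * x0)) ≤
      (prG r m p (ForbN r Fam m) + Real.exp (-s)) ^ d := by
  classical
  have hφ : ∀ i, ∃ φ : Fin m ↪ Fin n, Finset.univ.map φ = D i := fun i =>
    ⟨((D i).orderEmbOfFin (hcard i)).toEmbedding, by simp⟩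
  choose φ hφ using hφ
  -- number of bad indices
  let X : Finset (Finset (Fin n)) → ℝ := fun G =>
    ∑ i, if ∃ U ⊆ D i, HasCopyAt r n Fam G U then (1 : ℝ) else 0
  let g : Finset (Finset (Fin m)) → ℝ := fun H => if H ∈ ForbN r Fam m then 1 else Real.exp (-s)
  have hexp1 : Real.exp (-s) ≤ 1 := Real.exp_le_one_iff.2 (by linarith)
  have h1p : 0 < 1 - p := by linarith
  -- upper bound
  have hup : exS p (edgeUniv r n) (fun G => Real.exp (-(s * X G))) ≤
      (prG r m p (ForbN r Fam m) + Real.exp (-s)) ^ d := by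
    have h1 : exS p (edgeUniv r n) (fun G => Real.exp (-(s * X G))) ≤
        exS p (edgeUniv r n) (fun G => ∏ i, g (pbG r (φ i)
          (G ∩ Finset.powersetCard r (D i)))) := by
      refine exS_mono p hp0 hp1 _ _ _ fun G _ => ?_
      have : -(s * X G) = ∑ i, -(s * if ∃ U ⊆ D i, HasCopyAt r n Fam G U then (1 : ℝ) else 0) := by
        simp only [X, Finset.mul_sum, Finset.sum_neg_distrib]
      rw [this, Real.exp_sum]
      refine Finset.prod_le_prod (fun i _ => (Real.exp_pos _).le) fun i _ => ?_
      rw [← hφ i, pbG_inter]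
      simp only [g]
      by_cases hF : pbG r (φ i) G ∈ ForbN r Fam m
      · rw [if_pos hF]
        refine Real.exp_le_one_iff.2 ?_
        split_ifs <;> simp [hs.le]
      · rw [if_neg hF, if_pos (pbG_copy r Fam (φ i) G hF), mul_one]
    refine h1.trans ?_
    have h2 : exS p (edgeUniv r n) (fun G => ∏ i, g (pbG r (φ i)
          (G ∩ Finset.powersetCard r (D i)))) =
        ∏ i, exS p (Finset.powersetCard r (D i)) (fun G => g (pbG r (φ i) G)) := by
      rw [← exS_prod p (fun i => Finset.powersetCard r (D i)) (fun i G => g (pbG r (φ i) G))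
        Finset.univ (fun i _ j _ hij => hdisj i j hij)]
      rw [← exS_sub p (edgeUniv r n) (Finset.univ.biUnion fun i => Finset.powersetCard r (D i))]
      · refine exS_congr _ _ _ _ fun G _ => Finset.prod_congr rfl fun i hi => ?_
        rw [Finset.inter_assoc, Finset.inter_eq_right.2
          (Finset.subset_biUnion_of_mem (fun i => Finset.powersetCard r (D i)) hi)]
      · refine Finset.biUnion_subset.2 fun i _ => ?_
        exact Finset.powersetCard_mono (Finset.subset_univ _)
    rw [h2]
    have h3 : ∀ i, exS p (Finset.powersetCard r (D i)) (fun G => g (pbG r (φ i) G)) ≤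
        prG r m p (ForbN r Fam m) + Real.exp (-s) := by
      intro i
      rw [← hφ i, edges_map, exS_map]
      calc _ = exS p (edgeUniv r m) g :=
            exS_congr _ _ _ _ fun E hE => by rw [pbG_map r (φ i) E hE]
        _ ≤ exS p (edgeUniv r m)
            (fun E => Set.indicator (ForbN r Fam m) (fun _ => (1 : ℝ)) E + Real.exp (-s)) := by
            refine exS_mono p hp0 hp1 _ _ _ fun E _ => ?_
            by_cases h : E ∈ ForbN r Fam m <;> simp [g, h, Real.exp_nonneg]
        _ = prG r m p (ForbN r Fam m) + Real.exp (-s) := by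
            rw [prG_eq]
            have h4 : Real.exp (-s) = Real.exp (-s) * exS p (edgeUniv r m) (fun _ => 1) := by
              rw [exS_one, mul_one]
            refine Eq.trans ?_ (congrArg (_ + ·) h4.symm)
            simp only [exS, Finset.mul_sum]
            rw [← Finset.sum_add_distrib]
            refine Finset.sum_congr rfl fun E _ => ?_
            ring
    calc _ ≤ ∏ _i : Fin d, (prG r m p (ForbN r Fam m) + Real.exp (-s)) := by
          refine Finset.prod_le_prod (fun i _ => ?_) fun i _ => h3 i
          unfold exS
          refine Finset.sum_nonneg fun E _ => ?_
          have : 0 ≤ g (pbG r (φ i) E) := by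
            simp only [g]; split_ifs <;> positivity
          positivity
      _ = _ := by simp
  refine le_trans ?_ hup
  -- lower bound
  have hlow : exS p (edgeUniv r n) (fun G => Real.exp (-(s * x0)) *
      (Set.indicator A (fun G => 1 - s * X G + s * x0) G)) ≤
      exS p (edgeUniv r n) (fun G => Real.exp (-(s * X G))) := by
    refine exS_mono p hp0 hp1 _ _ _ fun G _ => ?_
    by_cases h : G ∈ A
    · rw [Set.indicator_of_mem h]
      have h1 := Real.add_one_le_exp (-(s * X G) + s * x0)
      calc Real.exp (-(s * x0)) * (1 - s * X G + s * x0)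
          ≤ Real.exp (-(s * x0)) * Real.exp (-(s * X G) + s * x0) :=
            mul_le_mul_of_nonneg_left (by linarith) (Real.exp_nonneg _)
        _ = _ := by rw [← Real.exp_add]; congr 1; ring
    · rw [Set.indicator_of_notMem h, mul_zero]; exact Real.exp_nonneg _
  refine le_trans ?_ hlow
  have hsumX : exS p (edgeUniv r n) (Set.indicator A X) =
      ∑ i, prG r n p {G | G ∈ A ∧ ∃ U ⊆ D i, HasCopyAt r n Fam G U} := by
    simp only [prG_eq, exS]
    rw [Finset.sum_comm]
    refine Finset.sum_congr rfl fun E _ => ?_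
    rw [← Finset.mul_sum]
    congr 1
    by_cases h : E ∈ A
    · rw [Set.indicator_of_mem h]
      refine Finset.sum_congr rfl fun i _ => ?_
      simp [Set.indicator_apply, h]
    · rw [Set.indicator_of_notMem h]
      symm
      refine Finset.sum_eq_zero fun i _ => ?_
      simp [Set.indicator_apply, h]
  have hsplit : exS p (edgeUniv r n) (fun G => Real.exp (-(s * x0)) *
      (Set.indicator A (fun G => 1 - s * X G + s * x0) G)) =
      Real.exp (-(s * x0)) * (prG r n p A - s * exS p (edgeUniv r n) (Set.indicator A X)
        + s * x0 * prG r n p A) := by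
    simp only [prG_eq, exS, Finset.mul_sum]
    rw [← Finset.sum_sub_distrib, ← Finset.sum_add_distrib, Finset.mul_sum]
    refine Finset.sum_congr rfl fun E _ => ?_
    by_cases h : E ∈ A
    · simp only [Set.indicator_of_mem h]; ring
    · simp only [Set.indicator_of_notMem h]; ring
  rw [hsplit, hsumX, mul_comm]
  refine mul_le_mul_of_nonneg_left ?_ (Real.exp_nonneg _)
  have := mul_le_mul_of_nonneg_left hx hs.le
  linarith

/-- **Lemma (edge partition).** With `c = c(p,Fam)` and `ε > 0`, there exist
`η, γ, λ > 0` and an integer `m` (depending only on `Fam`, `p`, `ε`) such that for all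
sufficiently large `n`: for any collection `A` of `r`-graphs on `n` vertices with
`μ_n(A) > 2 ^ ((-c+ε) C(n,r))` and any partial Steiner system `D₁, …, D_d` with
parameters `(r,m,n)` and `d ≥ (1-λ) C(n,r) C(m,r)⁻¹`, the set
`I = {i : μ_n({G ∈ A : Fam < G[Dᵢ]}) ≥ γ μ_n(A)}` has `|I| ≥ η d`. -/
theorem stmt_7 (r : ℕ) (Fam : ∀ k, Set (Finset (Finset (Fin k))))
    (hFam : ∀ k, ∀ H ∈ Fam k, IsRGraph r k H)
    (p : ℝ) (hp0 : 0 < p) (hp1 : p < 1) (c : ℝ)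
    (hc : Filter.Tendsto
      (fun n => -(Real.logb 2 (prG r n p (ForbN r Fam n))) / (n.choose r : ℝ))
      Filter.atTop (nhds c))
    (ε : ℝ) (hε : 0 < ε) :
    ∃ (η γ lam : ℝ) (m : ℕ), 0 < η ∧ 0 < γ ∧ 0 < lam ∧
      ∃ n₀ : ℕ, ∀ n, n₀ ≤ n →
      ∀ A : Set (Finset (Finset (Fin n))), (∀ G ∈ A, IsRGraph r n G) →
      2 ^ ((-c + ε) * (n.choose r : ℝ)) < prG r n p A →
      ∀ (d : ℕ) (D : Fin d → Finset (Fin n)), Function.Injective D →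
      IsSteiner r m n (Finset.univ.image D) →
      (1 - lam) * (n.choose r : ℝ) * ((m.choose r : ℝ))⁻¹ ≤ (d : ℝ) →
      η * (d : ℝ) ≤ (Set.ncard {i : Fin d |
        γ * prG r n p A ≤
          prG r n p {G | G ∈ A ∧ ∃ U ⊆ D i, HasCopyAt r n Fam G U}} : ℝ) := by
  classical
  -- choice of `m`
  obtain ⟨m, hmc, hmr⟩ := ((hc.eventually (lt_mem_nhds (show c - ε / 4 < c by linarith))).and
    (Filter.eventually_ge_atTop r)).exists
  set q := prG r m p (ForbN r Fam m) with hq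
  have h1p : 0 < 1 - p := by linarith
  have hpr_nonneg : ∀ (n : ℕ) (B : Set (Finset (Finset (Fin n)))), 0 ≤ prG r n p B := by
    intro n B
    unfold prG
    refine Finset.sum_nonneg fun E _ => Set.indicator_nonneg (fun _ _ => by positivity) _
  have hq0 : 0 ≤ q := hpr_nonneg _ _
  have hMpos : 0 < m.choose r := Nat.choose_pos hmr
  set M : ℝ := (m.choose r : ℝ) with hM
  have hM1 : 1 ≤ M := by rw [hM]; exact_mod_cast hMpos
  have hM0 : 0 < M := by linarith
  have hq1 : q ≤ (2 : ℝ) ^ ((-c + ε / 4) * M) := by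
    rcases hq0.eq_or_lt with h | h
    · rw [← h]; positivity
    · rw [← Real.logb_le_iff_le_rpow (by norm_num) h]
      rw [lt_div_iff₀ hM0] at hmc
      linarith
  have hgap : 0 < (2 : ℝ) ^ ((-c + ε / 2) * M) - (2 : ℝ) ^ ((-c + ε / 4) * M) := by
    rw [sub_pos]
    refine Real.rpow_lt_rpow_of_exponent_lt (by norm_num) ?_
    exact mul_lt_mul_of_pos_right (by linarith) hM0
  obtain ⟨s, hs, hsgap⟩ : ∃ s : ℝ, 0 < s ∧
      Real.exp (-s) ≤ (2 : ℝ) ^ ((-c + ε / 2) * M) - (2 : ℝ) ^ ((-c + ε / 4) * M) := by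
    refine ⟨max 1 (-Real.log ((2 : ℝ) ^ ((-c + ε / 2) * M) - (2 : ℝ) ^ ((-c + ε / 4) * M))),
      lt_of_lt_of_le one_pos (le_max_left _ _), ?_⟩
    rw [← Real.le_log_iff_exp_le hgap]
    have := le_max_right 1
      (-Real.log ((2 : ℝ) ^ ((-c + ε / 2) * M) - (2 : ℝ) ^ ((-c + ε / 4) * M)))
    linarith
  have hlog2 : 0 < Real.log 2 := Real.log_pos (by norm_num)
  refine ⟨ε * Real.log 2 / (8 * s), ε * Real.log 2 / (8 * s), ε / (4 * (|c| + 1)), m,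
    by positivity, by positivity, by positivity, 0, ?_⟩
  intro n _ A _ hA d D hDinj hSt hd
  by_contra hcon
  push Not at hcon
  set η := ε * Real.log 2 / (8 * s) with hη
  have hη0 : 0 < η := by positivity
  have hcard : ∀ i, (D i).card = m := fun i =>
    hSt.1 _ (Finset.mem_image_of_mem _ (Finset.mem_univ i))
  have hdisj : ∀ i j, i ≠ j →
      Disjoint (Finset.powersetCard r (D i)) (Finset.powersetCard r (D j)) := by
    intro i j hij
    rw [Finset.disjoint_left]
    intro e hi hj
    rw [Finset.mem_powersetCard] at hi hj
    exact hij (hDinj (hSt.2 e hi.2 _ (Finset.mem_image_of_mem _ (Finset.mem_univ i)) _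
      (Finset.mem_image_of_mem _ (Finset.mem_univ j)) hi.1 hj.1))
  have hdM : (d : ℝ) * M ≤ (n.choose r : ℝ) := by
    have h1 := Finset.card_le_card (Finset.biUnion_subset.2 (fun i (_ : i ∈ Finset.univ) =>
      Finset.powersetCard_mono (n := r) (Finset.subset_univ (D i))))
    rw [Finset.card_biUnion (fun i _ j _ hij => hdisj i j hij)] at h1
    simp only [Finset.card_powersetCard, hcard, Finset.sum_const, Finset.card_univ,
      Fintype.card_fin, smul_eq_mul] at h1
    rw [hM]; exact_mod_cast h1
  set C : ℝ := (n.choose r : ℝ) with hC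
  have hC0 : 0 ≤ C := by positivity
  have hApos : 0 ≤ prG r n p A := hpr_nonneg _ _
  set B : Fin d → Set (Finset (Finset (Fin n))) :=
    fun i => {G | G ∈ A ∧ ∃ U ⊆ D i, HasCopyAt r n Fam G U} with hB
  have hBA : ∀ i, prG r n p (B i) ≤ prG r n p A := by
    intro i
    unfold prG
    refine Finset.sum_le_sum fun E _ => ?_
    refine Set.indicator_le_indicator_of_subset (fun G hG => hG.1) (fun _ => by positivity) E
  have hx : ∑ i, prG r n p (B i) ≤ (2 * η * d) * prG r n p A := by
    have h1 : ∀ i, prG r n p (B i) ≤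
        (if η * prG r n p A ≤ prG r n p (B i) then prG r n p A else 0) + η * prG r n p A := by
      intro i
      split_ifs with h
      · have := hBA i
        have : 0 ≤ η * prG r n p A := by positivity
        linarith [hBA i]
      · linarith
    have h2 := Finset.sum_le_sum (fun i (_ : i ∈ (Finset.univ : Finset (Fin d))) => h1 i)
    rw [Finset.sum_add_distrib, ← Finset.sum_filter, Finset.sum_const, Finset.sum_const,
      Finset.card_univ, Fintype.card_fin, nsmul_eq_mul, nsmul_eq_mul] at h2
    have h3 : (Set.ncard {i : Fin d | η * prG r n p A ≤ prG r n p (B i)}) =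
        (Finset.univ.filter fun i : Fin d => η * prG r n p A ≤ prG r n p (B i)).card := by
      rw [← Set.ncard_coe_finset]; simp
    rw [h3] at hcon
    have h4 := mul_le_mul_of_nonneg_right hcon.le hApos
    linarith
  have hcore := core r n m d Fam p hp0 hp1 A D hcard hdisj s hs _ hx
  have hpow : (q + Real.exp (-s)) ^ d ≤ (2 : ℝ) ^ ((-c + ε / 2) * M * d) := by
    rw [Real.rpow_mul (by norm_num), Real.rpow_natCast]
    refine pow_le_pow_left₀ (by positivity) ?_ _
    linarith
  have hexp : Real.exp (-(s * (2 * η * d))) = (2 : ℝ) ^ (-(ε / 4 * d)) := by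
    rw [Real.rpow_def_of_pos (by norm_num), hη]
    congr 1
    field_simp
    ring
  rw [hexp] at hcore
  have hd' : (1 - ε / (4 * (|c| + 1))) * C ≤ d * M := by
    rwa [← div_eq_mul_inv, div_le_iff₀ hM0] at hd
  have hdC : (d : ℝ) ≤ C := by
    have : (d : ℝ) * 1 ≤ d * M := mul_le_mul_of_nonneg_left hM1 (by positivity)
    linarith
  have hcM : -c * (d * M) ≤ (-c + ε / 4) * C := by
    rcases le_total 0 c with h | h
    · have h1 := mul_le_mul_of_nonneg_left hd' h
      have h2 : c * (ε / (4 * (|c| + 1))) ≤ ε / 4 := by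
        rw [abs_of_nonneg h, mul_div_assoc', div_le_div_iff₀ (by positivity) (by norm_num)]
        nlinarith
      have h3 := mul_le_mul_of_nonneg_right h2 hC0
      nlinarith
    · have h1 := mul_le_mul_of_nonneg_left hdM (neg_nonneg.2 h)
      have : 0 ≤ ε / 4 * C := by positivity
      linarith
  have hfin : prG r n p A ≤ (2 : ℝ) ^ ((-c + ε) * C) := by
    have h1 : prG r n p A * (2 : ℝ) ^ (-(ε / 4 * d)) ≤ (2 : ℝ) ^ ((-c + ε / 2) * M * d) :=
      hcore.trans hpow
    rw [Real.rpow_neg (by norm_num), ← div_eq_mul_inv, div_le_iff₀ (by positivity),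
      ← Real.rpow_add (by norm_num)] at h1
    refine h1.trans (Real.rpow_le_rpow_of_exponent_le (by norm_num) ?_)
    have e1 : ε / 2 * (d * M) ≤ ε / 2 * C := mul_le_mul_of_nonneg_left hdM (by positivity)
    have e2 : ε / 4 * d ≤ ε / 4 * C := mul_le_mul_of_nonneg_left hdC (by positivity)
    linarith
  linarith
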